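/- Let T = X + iY satisfy assumption (A). Then for every ψ that is either in C¹₁([a,b]) or a polynomial with complex coefficients, the commutator [Y, ψ(X)] is a trace-class operator and −i Tr([Y, ψ(X)]) = Tr(ψ′(X) D²). -/

import Mathlib

open scoped InnerProductSpace
open MeasureTheory Polynomial

namespace HHCP

variable {H : Type*} [NormedAddCommGroup H] [InnerProductSpace ℂ H] [CompleteSpace H]
  [TopologicalSpace.SeparableSpace H]

/-- `f(A)` for a function `f` of a real variable, applied to the (selfadjoint, hence
star-normal) bounded operator `A` via the continuous functional calculus. -/
noncomputable def fc (f : ℝ → ℂ) (A : H →L[ℂ] H) : H →L[ℂ] H :=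
  cfc (fun z : ℂ => f z.re) A

/-- `|A| = √(A⋆A)`. -/
noncomputable def absOp (A : H →L[ℂ] H) : H →L[ℂ] H :=
  cfc Real.sqrt (ContinuousLinearMap.adjoint A * A)

/-- `A` is of trace class, i.e. `∑ ⟪eᵢ, |A| eᵢ⟫ < ∞` (this is independent of the
choice of the Hilbert basis `e`). -/
def IsTraceClass {ι : Type*} (e : HilbertBasis ι ℂ H) (A : H →L[ℂ] H) : Prop :=
  Summable fun i => (⟪e i, absOp A (e i)⟫_ℂ).re

/-- The trace norm `‖A‖₁ = Tr |A|`. -/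
noncomputable def traceNorm {ι : Type*} (e : HilbertBasis ι ℂ H) (A : H →L[ℂ] H) : ℝ :=
  ∑' i, (⟪e i, absOp A (e i)⟫_ℂ).re

/-- The trace `Tr A = ∑ᵢ ⟪eᵢ, A eᵢ⟫`. -/
noncomputable def trace {ι : Type*} (e : HilbertBasis ι ℂ H) (A : H →L[ℂ] H) : ℂ :=
  ∑' i, ⟪e i, A (e i)⟫_ℂ

/-- `T` is hyponormal (`‖T⋆x‖ ≤ ‖Tx‖`, i.e. `[T⋆,T] ≥ 0`) and *purely* so: there is no
nonzero closed subspace, invariant under `T` and `T⋆`, on which `T` is normal. -/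
def PurelyHyponormal (T : H →L[ℂ] H) : Prop :=
  (∀ x : H, ‖ContinuousLinearMap.adjoint T x‖ ≤ ‖T x‖) ∧
  ∀ S : Submodule ℂ H, IsClosed (S : Set H) →
    (∀ x ∈ S, T x ∈ S) → (∀ x ∈ S, ContinuousLinearMap.adjoint T x ∈ S) →
    (∀ x ∈ S, ‖T x‖ = ‖ContinuousLinearMap.adjoint T x‖) → S = ⊥

/-- Assumption (A): `T = X + iY` is purely hyponormal with `X, Y` selfadjoint,
`[T⋆,T] = −2i[Y,X] = 2D²` is a positive trace-class operator, and
`σ(X) ∪ σ(Y) ⊆ [a,b]`. -/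
structure AssumptionA {ι : Type*} (e : HilbertBasis ι ℂ H)
    (X Y D2 : H →L[ℂ] H) (a b : ℝ) : Prop where
  hab : a ≤ b
  hX : IsSelfAdjoint X
  hY : IsSelfAdjoint Y
  hpure : PurelyHyponormal (X + Complex.I • Y)
  hD2 : (2 : ℂ) • D2 = (-(2 : ℂ) * Complex.I) • (Y * X - X * Y)
  hpos : D2.IsPositive
  htc : IsTraceClass e D2
  hspecX : spectrum ℝ X ⊆ Set.Icc a b
  hspecY : spectrum ℝ Y ⊆ Set.Icc a b

/-- `ψ ∈ C¹₁`: `ψ(β) = (2π)^{-1/2} ∫ ψ̂(α) e^{iαβ} dα` for some `ψ̂` with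
`∫ |ψ̂(α)|(1+|α|) dα < ∞`. -/
def MemC11 (ψ : ℝ → ℂ) : Prop :=
  ∃ g : ℝ → ℂ, Integrable g ∧ Integrable (fun α : ℝ => α • g α) ∧
    ∀ β : ℝ, ψ β = (Real.sqrt (2 * Real.pi))⁻¹ •
      ∫ α : ℝ, Complex.exp (Complex.I * (α : ℂ) * (β : ℂ)) • g α

/-- `ψ` is (the function given by) a polynomial with complex coefficients. -/
def IsPolyFun (ψ : ℝ → ℂ) : Prop :=
  ∃ p : Polynomial ℂ, ∀ t : ℝ, ψ t = Polynomial.eval (t : ℂ) p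

/-- `ψ` is either in `C¹₁([a,b])` or a polynomial. -/
def GoodFun (ψ : ℝ → ℂ) : Prop := MemC11 ψ ∨ IsPolyFun ψ

/-- `E` is the spectral measure of the selfadjoint operator `A`: a projection-valued,
countably additive measure on `ℝ` such that `⟪x, f(A) x⟫ = ∫ f dμ_x`, where `μ_x` is the
finite positive measure `μ_x(Δ) = ⟪x, E(Δ) x⟫`. -/
def IsSpectralMeasureOf (A : H →L[ℂ] H) (E : Set ℝ → H →L[ℂ] H) : Prop :=
  (∀ Δ : Set ℝ, IsSelfAdjoint (E Δ)) ∧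
  (∀ Δ Ω : Set ℝ, E (Δ ∩ Ω) = E Δ * E Ω) ∧
  E Set.univ = 1 ∧
  (∀ Δ : ℕ → Set ℝ, (∀ n, MeasurableSet (Δ n)) → Pairwise (Function.onFun Disjoint Δ) →
    ∀ x : H, HasSum (fun n => E (Δ n) x) (E (⋃ n, Δ n) x)) ∧
  ∀ x : H, ∃ μ : Measure ℝ, IsFiniteMeasure μ ∧
    (∀ Δ : Set ℝ, MeasurableSet Δ → (μ Δ).toReal = (⟪x, E Δ x⟫_ℂ).re) ∧
    ∀ f : ℝ → ℝ, Continuous f → (⟪x, cfc f A x⟫_ℂ).re = ∫ t, f t ∂μ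

/-- An indefinite integral `𝒥(χ_Δ)` of the characteristic function of `Δ`. -/
noncomputable def Jind (a : ℝ) (Δ : Set ℝ) (t : ℝ) : ℝ :=
  ∫ s in a..t, Set.indicator Δ (fun _ => (1 : ℝ)) s

/-- `𝒥(χ_Δ)(A)`. -/
noncomputable def JindOp (a : ℝ) (Δ : Set ℝ) (A : H →L[ℂ] H) : H →L[ℂ] H :=
  fc (fun t => (Jind a Δ t : ℂ)) A

/-- `ψ ∈ C¹([a,b])` with derivative `ψd` on `[a,b]`. -/
def HasDerivOnIcc (ψ ψd : ℝ → ℂ) (a b : ℝ) : Prop :=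
  (∀ t ∈ Set.Icc a b, HasDerivWithinAt ψ (ψd t) (Set.Icc a b) t) ∧
  ContinuousOn ψd (Set.Icc a b)

/-- `r` is a Carey–Pincus principal function for the pair `X, Y`: a nonnegative
`L¹([a,b]²)` function with `Tr(−i[ψ(Y), φ(X)]) = ∫∫ φ′(t) ψ′(λ) r(t,λ) dt dλ`
for all `ψ, φ ∈ C¹([a,b])`. -/
def IsPrincipalFunction {ι : Type*} (e : HilbertBasis ι ℂ H) (X Y : H →L[ℂ] H)
    (a b : ℝ) (r : ℝ → ℝ → ℝ) : Prop :=
  IntegrableOn (fun q : ℝ × ℝ => r q.1 q.2) (Set.Icc a b ×ˢ Set.Icc a b) ∧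
  (∀ᵐ q : ℝ × ℝ ∂(volume : Measure (ℝ × ℝ)),
    q ∈ Set.Icc a b ×ˢ Set.Icc a b → 0 ≤ r q.1 q.2) ∧
  ∀ ψ ψd φ φd : ℝ → ℂ, HasDerivOnIcc ψ ψd a b → HasDerivOnIcc φ φd a b →
    trace e ((-Complex.I) • (fc ψ Y * fc φ X - fc φ X * fc ψ Y)) =
      ∫ t in Set.Icc a b, ∫ l in Set.Icc a b, φd t * ψd l * (r t l : ℂ)

/-- The Jacobian `J(F,G)(t,λ) = ∂F/∂t ∂G/∂λ − ∂F/∂λ ∂G/∂t`. -/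
noncomputable def Jac (F G : ℝ → ℝ → ℂ) (t l : ℝ) : ℂ :=
  deriv (fun s => F s l) t * deriv (fun s => G t s) l -
    deriv (fun s => F t s) l * deriv (fun s => G s l) t

set_option linter.unusedSectionVars false

section HS
variable {ι : Type*} (e : HilbertBasis ι ℂ H)

lemma parseval (x : H) : HasSum (fun i => ‖⟪x, e i⟫_ℂ‖ ^ 2) (‖x‖ ^ 2) := by
  have h := e.hasSum_inner_mul_inner x x
  have h2 := Complex.hasSum_re h
  convert h2 using 1
  · funext i
    rw [← inner_conj_symm (e i) x, Complex.mul_conj, Complex.normSq_eq_norm_sq]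
    norm_cast
  · rw [inner_self_eq_norm_sq_to_K]; norm_cast

lemma hs_prod (A : H →L[ℂ] H) (hA : Summable fun j => ‖A (e j)‖ ^ 2) :
    Summable (fun q : ι × ι => ‖⟪A (e q.1), e q.2⟫_ℂ‖ ^ 2) := by
  rw [summable_prod_of_nonneg (fun _ => by positivity)]
  refine ⟨fun j => (parseval e (A (e j))).summable, ?_⟩
  refine hA.congr fun j => ?_
  exact (parseval e (A (e j))).tsum_eq.symm

lemma hs_adj (A : H →L[ℂ] H) (hA : Summable fun j => ‖A (e j)‖ ^ 2) :
    HasSum (fun i => ‖ContinuousLinearMap.adjoint A (e i)‖ ^ 2) (∑' j, ‖A (e j)‖ ^ 2) := by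
  have h := hs_prod e A hA
  have h1 : ∑' q : ι × ι, ‖⟪A (e q.1), e q.2⟫_ℂ‖ ^ 2 = ∑' j, ‖A (e j)‖ ^ 2 := by
    rw [h.tsum_prod]
    refine tsum_congr fun j => ?_
    exact (parseval e (A (e j))).tsum_eq
  have h2 : HasSum (fun q : ι × ι => ‖⟪A (e q.2), e q.1⟫_ℂ‖ ^ 2) (∑' j, ‖A (e j)‖ ^ 2) := by
    rw [← h1]
    exact (Equiv.prodComm ι ι).hasSum_iff.2 h.hasSum
  refine h2.prod_fiberwise fun i => ?_
  convert parseval e (ContinuousLinearMap.adjoint A (e i)) using 2 with j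
  rw [ContinuousLinearMap.adjoint_inner_left, norm_inner_symm]

lemma hs_swap (A B : H →L[ℂ] H) (hA : Summable fun j => ‖A (e j)‖ ^ 2)
    (hB : Summable fun j => ‖B (e j)‖ ^ 2) :
    ∑' i, ⟪ContinuousLinearMap.adjoint A (e i), ContinuousLinearMap.adjoint B (e i)⟫_ℂ
      = ∑' j, ⟪B (e j), A (e j)⟫_ℂ := by
  have hs : Summable (fun q : ι × ι => ⟪B (e q.1), e q.2⟫_ℂ * ⟪e q.2, A (e q.1)⟫_ℂ) := by
    refine Summable.of_norm_bounded ((hs_prod e B hB).add (hs_prod e A hA)) fun q => ?_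
    rw [norm_mul, norm_inner_symm (e q.2)]
    nlinarith [sq_nonneg (‖⟪B (e q.1), e q.2⟫_ℂ‖ - ‖⟪A (e q.1), e q.2⟫_ℂ‖),
      sq_nonneg (‖⟪B (e q.1), e q.2⟫_ℂ‖), sq_nonneg ‖⟪A (e q.1), e q.2⟫_ℂ‖]
  have h1 : ∀ i, ∑' j, ⟪B (e j), e i⟫_ℂ * ⟪e i, A (e j)⟫_ℂ =
      ⟪ContinuousLinearMap.adjoint A (e i), ContinuousLinearMap.adjoint B (e i)⟫_ℂ := by
    intro i
    rw [← (e.hasSum_inner_mul_inner _ _).tsum_eq]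
    congr 1; funext j
    rw [ContinuousLinearMap.adjoint_inner_left, ContinuousLinearMap.adjoint_inner_right, mul_comm]
  have h2 : ∀ j, ∑' i, ⟪B (e j), e i⟫_ℂ * ⟪e i, A (e j)⟫_ℂ = ⟪B (e j), A (e j)⟫_ℂ :=
    fun j => (e.hasSum_inner_mul_inner _ _).tsum_eq
  simp_rw [← h1, ← h2]
  exact Summable.tsum_comm hs

/-- Uniform trace-class bound. -/
def TC (K : ℝ) (A : H →L[ℂ] H) : Prop :=
  ∀ W : H →L[ℂ] H, ‖W‖ ≤ 1 → ∀ F : Finset ι, ∑ i ∈ F, ‖⟪W (e i), A (e i)⟫_ℂ‖ ≤ K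

lemma TC.add {K L : ℝ} {A B : H →L[ℂ] H} (hA : TC e K A) (hB : TC e L B) :
    TC e (K + L) (A + B) := by
  intro W hW F
  refine le_trans ?_ (add_le_add (hA W hW F) (hB W hW F))
  rw [← Finset.sum_add_distrib]
  refine Finset.sum_le_sum fun i _ => ?_
  rw [add_apply, inner_add_right]
  exact norm_add_le _ _

lemma TC.smul {K : ℝ} {A : H →L[ℂ] H} (c : ℂ) (hA : TC e K A) :
    TC e (‖c‖ * K) (c • A) := by
  intro W hW F
  refine le_trans (le_of_eq ?_) (mul_le_mul_of_nonneg_left (hA W hW F) (norm_nonneg c))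
  rw [Finset.mul_sum]
  refine Finset.sum_congr rfl fun i _ => ?_
  rw [smul_apply, inner_smul_right, norm_mul]

lemma TC.mono {K L : ℝ} {A : H →L[ℂ] H} (hA : TC e K A) (h : K ≤ L) : TC e L A :=
  fun W hW F => (hA W hW F).trans h

lemma norm_one_le : ‖(1 : H →L[ℂ] H)‖ ≤ 1 := ContinuousLinearMap.norm_id_le

lemma TC.summable {K : ℝ} {A : H →L[ℂ] H} (hA : TC e K A) :
    Summable fun i => ⟪e i, A (e i)⟫_ℂ :=
  Summable.of_norm (summable_of_sum_le (fun _ => norm_nonneg _) (hA 1 norm_one_le))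

lemma trace_add {K L : ℝ} {A B : H →L[ℂ] H} (hA : TC e K A) (hB : TC e L B) :
    trace e (A + B) = trace e A + trace e B := by
  unfold trace
  rw [← (hA.summable).tsum_add hB.summable]
  simp

lemma trace_smul (c : ℂ) (A : H →L[ℂ] H) : trace e (c • A) = c * trace e A := by
  unfold trace
  rw [← tsum_mul_left]
  simp

lemma exists_contraction (A : H →L[ℂ] H) {ε : ℝ} (hε : 0 < ε) :
    ∃ W : H →L[ℂ] H, ‖W‖ ≤ 1 ∧ ‖absOp A - ContinuousLinearMap.adjoint W * A‖ ≤ ε := by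
  set P := ContinuousLinearMap.adjoint A * A with hP
  have hPpos : 0 ≤ P := by
    rw [hP, ← ContinuousLinearMap.star_eq_adjoint]; exact star_mul_self_nonneg A
  have hPsa : IsSelfAdjoint P := hPpos.isSelfAdjoint
  have hspec : ∀ x ∈ spectrum ℝ P, 0 ≤ x := fun x hx => spectrum_nonneg_of_nonneg hPpos hx
  have hne : ∀ x : ℝ, Real.sqrt x + ε ≠ 0 := fun x => by positivity
  set g : ℝ → ℝ := fun x => (Real.sqrt x + ε)⁻¹ with hg
  have hgc : Continuous g := by
    rw [hg]; exact Continuous.inv₀ (by fun_prop) hne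
  have hid : cfc (fun x : ℝ => x) P = P := cfc_id' ℝ P
  have hstar : star (cfc g P) = cfc g P := (cfc_predicate g P : IsSelfAdjoint _).star_eq
  have hAA : star A * A = P := rfl
  have h1 : cfc g P * P = cfc (fun x => g x * x) P := by
    rw [cfc_mul g (fun x => x) P hgc.continuousOn (by fun_prop), hid]
  refine ⟨A * cfc g P, ?_, ?_⟩
  · have h2 : ‖A * cfc g P‖ * ‖A * cfc g P‖ ≤ 1 := by
      rw [← CStarRing.norm_star_mul_self, star_mul, hstar, mul_assoc, ← mul_assoc (star A), hAA,
        ← mul_assoc, h1, ← cfc_mul _ _ P (by fun_prop) (by fun_prop)]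
      refine norm_cfc_le zero_le_one fun x hx => ?_
      have hx0 := hspec x hx
      have hs := Real.sqrt_nonneg x
      have : g x * x * g x = (Real.sqrt x / (Real.sqrt x + ε)) ^ 2 := by
        rw [div_pow, Real.sq_sqrt hx0, hg]; have := hne x; field_simp
      rw [this, Real.norm_of_nonneg (by positivity)]
      apply pow_le_one₀ (by positivity)
      rw [div_le_one (by positivity)]; linarith
    nlinarith [norm_nonneg (A * cfc g P)]
  · rw [← ContinuousLinearMap.star_eq_adjoint, star_mul, hstar, mul_assoc, hAA, h1, absOp, ← hP,
      ← cfc_sub _ _ P (by fun_prop) (by fun_prop)]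
    refine norm_cfc_le hε.le fun x hx => ?_
    have hx0 := hspec x hx
    have hs := Real.sqrt_nonneg x
    have : Real.sqrt x - g x * x = ε * (Real.sqrt x / (Real.sqrt x + ε)) := by
      have h3 : g x * x = Real.sqrt x ^ 2 / (Real.sqrt x + ε) := by
        rw [Real.sq_sqrt hx0, hg]; ring
      rw [h3]; have := hne x; field_simp; ring
    rw [this, Real.norm_of_nonneg (by positivity)]
    have : Real.sqrt x / (Real.sqrt x + ε) ≤ 1 := by
      rw [div_le_one (by positivity)]; linarith
    nlinarith

lemma absOp_nonneg (A : H →L[ℂ] H) (x : H) : 0 ≤ (⟪x, absOp A x⟫_ℂ).re := by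
  have h : 0 ≤ absOp A := cfc_nonneg (fun _ _ => Real.sqrt_nonneg _)
  rw [ContinuousLinearMap.nonneg_iff_isPositive] at h
  exact h.re_inner_nonneg_right x

lemma TC.isTraceClass {K : ℝ} {A : H →L[ℂ] H} (hA : TC e K A) : IsTraceClass e A := by
  refine summable_of_sum_le (c := K) (fun i => absOp_nonneg A _) fun F => ?_
  refine le_of_forall_pos_le_add fun δ hδ => ?_
  obtain ⟨W, hW, hWA⟩ := exists_contraction A (ε := δ / (F.card + 1)) (by positivity)
  have key : ∀ i, (⟪e i, absOp A (e i)⟫_ℂ).re ≤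
      ‖⟪W (e i), A (e i)⟫_ℂ‖ + δ / (F.card + 1) := by
    intro i
    have h1 : ⟪e i, absOp A (e i)⟫_ℂ = ⟪W (e i), A (e i)⟫_ℂ +
        ⟪e i, (absOp A - ContinuousLinearMap.adjoint W * A) (e i)⟫_ℂ := by
      rw [sub_apply, inner_sub_right, mul_apply_eq_comp,
        ContinuousLinearMap.adjoint_inner_right]; ring
    have hn : ‖e i‖ = 1 := e.orthonormal.norm_eq_one i
    have h2 : ‖⟪e i, (absOp A - ContinuousLinearMap.adjoint W * A) (e i)⟫_ℂ‖ ≤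
        δ / (F.card + 1) := by
      refine (norm_inner_le_norm _ _).trans ?_
      rw [hn, one_mul]
      refine (ContinuousLinearMap.le_opNorm _ _).trans ?_
      rw [hn, mul_one]; exact hWA
    rw [h1]
    refine (Complex.re_le_norm _).trans ((norm_add_le _ _).trans ?_)
    linarith
  refine (Finset.sum_le_sum fun i _ => key i).trans ?_
  rw [Finset.sum_add_distrib, Finset.sum_const, nsmul_eq_mul]
  refine add_le_add (hA W hW F) ?_
  rw [mul_div_assoc', div_le_iff₀ (by positivity)]
  nlinarith

lemma TC.integral {S : Type*} [MeasurableSpace S] {μ : Measure S} {F : S → H →L[ℂ] H}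
    {K : S → ℝ} (hF : Integrable F μ) (hK : Integrable K μ) (h : ∀ s, TC e (K s) (F s)) :
    TC e (∫ s, K s ∂μ) (∫ s, F s ∂μ) := by
  intro W hW G
  have hint : ∀ i, Integrable (fun s => ⟪W (e i), F s (e i)⟫_ℂ) μ := fun i =>
    (hF.apply_continuousLinearMap (e i)).const_inner (W (e i))
  have h1 : ∀ i, ⟪W (e i), (∫ s, F s ∂μ) (e i)⟫_ℂ = ∫ s, ⟪W (e i), F s (e i)⟫_ℂ ∂μ := by
    intro i
    rw [ContinuousLinearMap.integral_apply hF,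
      integral_inner (hF.apply_continuousLinearMap (e i))]
  simp_rw [h1]
  calc _ ≤ ∑ i ∈ G, ∫ s, ‖⟪W (e i), F s (e i)⟫_ℂ‖ ∂μ :=
        Finset.sum_le_sum fun i _ => norm_integral_le_integral_norm _
    _ = ∫ s, ∑ i ∈ G, ‖⟪W (e i), F s (e i)⟫_ℂ‖ ∂μ :=
        (integral_finsetSum _ fun i _ => (hint i).norm).symm
    _ ≤ _ := integral_mono (integrable_finsetSum _ fun i _ => (hint i).norm) hK
        fun s => h s W hW G

lemma trace_integral [Countable ι] {S : Type*} [MeasurableSpace S] {μ : Measure S}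
    {F : S → H →L[ℂ] H}
    {K : S → ℝ} (hF : Integrable F μ) (hK : Integrable K μ) (h : ∀ s, TC e (K s) (F s)) :
    trace e (∫ s, F s ∂μ) = ∫ s, trace e (F s) ∂μ := by
  have hint : ∀ i, Integrable (fun s => ⟪e i, F s (e i)⟫_ℂ) μ := fun i =>
    (hF.apply_continuousLinearMap (e i)).const_inner (e i)
  have h1 : ∀ i, ⟪e i, (∫ s, F s ∂μ) (e i)⟫_ℂ = ∫ s, ⟪e i, F s (e i)⟫_ℂ ∂μ := by
    intro i
    rw [ContinuousLinearMap.integral_apply hF,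
      integral_inner (hF.apply_continuousLinearMap (e i))]
  unfold trace
  simp_rw [h1]
  refine (hasSum_integral_of_summable_integral_norm hint ?_).tsum_eq
  refine summable_of_sum_le (c := ∫ s, K s ∂μ) (fun i => integral_nonneg fun _ => norm_nonneg _)
    fun G => ?_
  rw [← integral_finsetSum _ fun i _ => (hint i).norm]
  exact integral_mono (integrable_finsetSum _ fun i _ => (hint i).norm) hK
        fun s => h s 1 norm_one_le G

lemma absOp_of_pos {A : H →L[ℂ] H} (hA : A.IsPositive) : absOp A = A := by
  have h0 : 0 ≤ A := (ContinuousLinearMap.nonneg_iff_isPositive A).2 hA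
  have hsa : IsSelfAdjoint A := h0.isSelfAdjoint
  have h1 : ContinuousLinearMap.adjoint A * A = cfc (fun x : ℝ => x ^ 2) A := by
    rw [cfc_pow (fun x : ℝ => x) 2 A, cfc_id' ℝ A, sq, ← ContinuousLinearMap.star_eq_adjoint, hsa.star_eq]
  rw [absOp, h1, ← cfc_comp' Real.sqrt (fun x : ℝ => x ^ 2) A]
  conv_rhs => rw [← cfc_id' ℝ A]
  refine cfc_congr fun x hx => ?_
  exact Real.sqrt_sq (spectrum_nonneg_of_nonneg h0 hx)

lemma exists_sqrt {A : H →L[ℂ] H} (hA : A.IsPositive) (hT : IsTraceClass e A) :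
    ∃ D : H →L[ℂ] H, IsSelfAdjoint D ∧ D * D = A ∧ Summable fun j => ‖D (e j)‖ ^ 2 := by
  have h0 : 0 ≤ A := (ContinuousLinearMap.nonneg_iff_isPositive A).2 hA
  have hsa : IsSelfAdjoint A := h0.isSelfAdjoint
  have hD : IsSelfAdjoint (cfc Real.sqrt A) := cfc_predicate _ _
  have hDD : cfc Real.sqrt A * cfc Real.sqrt A = A := by
    rw [← cfc_mul _ _ A]
    conv_rhs => rw [← cfc_id' ℝ A]
    refine cfc_congr fun x hx => ?_
    exact Real.mul_self_sqrt (spectrum_nonneg_of_nonneg h0 hx)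
  refine ⟨cfc Real.sqrt A, hD, hDD, ?_⟩
  unfold IsTraceClass at hT
  rw [absOp_of_pos hA] at hT
  refine hT.congr fun j => ?_
  have hAe : A (e j) = cfc Real.sqrt A (cfc Real.sqrt A (e j)) := by
    conv_lhs => rw [← hDD]
    rfl
  rw [hAe, ← ContinuousLinearMap.adjoint_inner_left,
    ← ContinuousLinearMap.star_eq_adjoint, hD.star_eq, inner_self_eq_norm_sq_to_K]
  norm_cast

lemma countable_index {ι : Type*} (e : HilbertBasis ι ℂ H) : Countable ι := by
  refine Pairwise.countable_of_isOpen_disjoint (s := fun i : ι => Metric.ball (e i) (1 / 2))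
    (fun i j hij => ?_) (fun i => Metric.isOpen_ball) (fun i => ⟨e i, by simp⟩)
  refine Metric.ball_disjoint_ball ?_
  have h : ‖e i - e j‖ ^ 2 = 2 := by
    rw [@norm_sub_sq ℂ, e.orthonormal.norm_eq_one, e.orthonormal.norm_eq_one,
      e.orthonormal.2 hij]
    norm_num
  rw [dist_eq_norm]
  nlinarith [norm_nonneg (e i - e j)]

lemma hs_comp {D : H →L[ℂ] H} (hD : IsSelfAdjoint D) (hS : Summable fun j => ‖D (e j)‖ ^ 2)
    (R : H →L[ℂ] H) (F : Finset ι) :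
    ∑ i ∈ F, ‖D (R (e i))‖ ^ 2 ≤ ‖R‖ ^ 2 * ∑' j, ‖D (e j)‖ ^ 2 := by
  have hb : ∀ j, ‖(ContinuousLinearMap.adjoint R * D) (e j)‖ ^ 2 ≤ ‖R‖ ^ 2 * ‖D (e j)‖ ^ 2 := by
    intro j
    rw [mul_apply_eq_comp, ← mul_pow]
    gcongr
    refine (ContinuousLinearMap.le_opNorm _ _).trans (le_of_eq ?_)
    rw [LinearIsometryEquiv.norm_map]
  have hs : Summable fun j => ‖(ContinuousLinearMap.adjoint R * D) (e j)‖ ^ 2 :=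
    Summable.of_nonneg_of_le (fun _ => by positivity) hb (hS.mul_left _)
  have h := hs_adj e _ hs
  have h2 : ∀ i, ContinuousLinearMap.adjoint (ContinuousLinearMap.adjoint R * D) (e i)
      = D (R (e i)) := by
    intro i
    rw [← ContinuousLinearMap.star_eq_adjoint, ← ContinuousLinearMap.star_eq_adjoint, star_mul,
      star_star, hD.star_eq]; rfl
  simp_rw [h2] at h
  refine (sum_le_hasSum F (fun _ _ => by positivity) h).trans ?_
  rw [← tsum_mul_left]
  exact hs.tsum_le_tsum hb (hS.mul_left _)

lemma tc_mul {D : H →L[ℂ] H} (hD : IsSelfAdjoint D) (hS : Summable fun j => ‖D (e j)‖ ^ 2)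
    (B C : H →L[ℂ] H) :
    TC e ((‖B‖ ^ 2 + ‖C‖ ^ 2) / 2 * ∑' j, ‖D (e j)‖ ^ 2) (B * (D * D) * C) := by
  intro W hW F
  set M := ∑' j, ‖D (e j)‖ ^ 2
  have hM : 0 ≤ M := tsum_nonneg fun _ => by positivity
  have key : ∀ i, ‖⟪W (e i), (B * (D * D) * C) (e i)⟫_ℂ‖ ≤
      (‖D ((ContinuousLinearMap.adjoint B * W) (e i))‖ ^ 2 + ‖D (C (e i))‖ ^ 2) / 2 := by
    intro i
    have : ⟪W (e i), (B * (D * D) * C) (e i)⟫_ℂ =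
        ⟪D ((ContinuousLinearMap.adjoint B * W) (e i)), D (C (e i))⟫_ℂ := by
      conv_rhs => rw [← hD.star_eq, ContinuousLinearMap.star_eq_adjoint,
        ContinuousLinearMap.adjoint_inner_left, mul_apply_eq_comp,
        ContinuousLinearMap.adjoint_inner_left, ← ContinuousLinearMap.star_eq_adjoint, hD.star_eq]
      rfl
    rw [this]
    refine (norm_inner_le_norm _ _).trans ?_
    nlinarith [sq_nonneg (‖D ((ContinuousLinearMap.adjoint B * W) (e i))‖ - ‖D (C (e i))‖)]
  refine (Finset.sum_le_sum fun i _ => key i).trans ?_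
  rw [← Finset.sum_div, Finset.sum_add_distrib]
  have h1 := hs_comp e hD hS (ContinuousLinearMap.adjoint B * W) F
  have h2 := hs_comp e hD hS C F
  have h3 : ‖ContinuousLinearMap.adjoint B * W‖ ≤ ‖B‖ := by
    refine (norm_mul_le _ _).trans ?_
    rw [LinearIsometryEquiv.norm_map]
    exact mul_le_of_le_one_right (norm_nonneg _) hW
  have h4 : ‖ContinuousLinearMap.adjoint B * W‖ ^ 2 * M ≤ ‖B‖ ^ 2 * M := by gcongr
  linarith

lemma trace_aux {D : H →L[ℂ] H} (hD : IsSelfAdjoint D) (hS : Summable fun j => ‖D (e j)‖ ^ 2)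
    (B C : H →L[ℂ] H) :
    trace e (B * (D * D) * C) = ∑' j, ⟪D (e j), (C * B) (D (e j))⟫_ℂ := by
  have hb : ∀ R : H →L[ℂ] H, Summable fun j => ‖(R * D) (e j)‖ ^ 2 := by
    intro R
    refine Summable.of_nonneg_of_le (fun _ => by positivity) (fun j => ?_) (hS.mul_left (‖R‖ ^ 2))
    rw [mul_apply_eq_comp, ← mul_pow]
    gcongr
    exact ContinuousLinearMap.le_opNorm _ _
  have h := hs_swap e (B * D) (ContinuousLinearMap.adjoint C * D) (hb _) (hb _)
  have h1 : ∀ j, ⟪(ContinuousLinearMap.adjoint C * D) (e j), (B * D) (e j)⟫_ℂ =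
      ⟪D (e j), (C * B) (D (e j))⟫_ℂ := by
    intro j
    rw [mul_apply_eq_comp, ContinuousLinearMap.adjoint_inner_left]; rfl
  have h2 : ∀ i, ⟪ContinuousLinearMap.adjoint (B * D) (e i),
      ContinuousLinearMap.adjoint (ContinuousLinearMap.adjoint C * D) (e i)⟫_ℂ =
      ⟪e i, (B * (D * D) * C) (e i)⟫_ℂ := by
    intro i
    rw [ContinuousLinearMap.adjoint_inner_left, ← ContinuousLinearMap.star_eq_adjoint,
      ← ContinuousLinearMap.star_eq_adjoint, star_mul, star_star, hD.star_eq]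
    rfl
  simp_rw [h1, h2] at h
  exact h

lemma trace_cyc {D : H →L[ℂ] H} (hD : IsSelfAdjoint D) (hS : Summable fun j => ‖D (e j)‖ ^ 2)
    (B C : H →L[ℂ] H) :
    trace e (B * (D * D) * C) = trace e (C * B * (D * D)) := by
  have h := trace_aux e hD hS (C * B) 1
  rw [mul_one, one_mul] at h
  rw [trace_aux e hD hS, h]

end HS

/-- The unitary group generated by `X`. -/
noncomputable def U (X : H →L[ℂ] H) (α : ℝ) : H →L[ℂ] H :=
  NormedSpace.exp (α • (Complex.I • X))

lemma U_cont (X : H →L[ℂ] H) : Continuous (U X) := by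
  rw [continuous_iff_continuousAt]
  intro t
  exact (hasDerivAt_exp_smul_const (Complex.I • X) t).continuousAt

lemma U_add (X : H →L[ℂ] H) (s t : ℝ) : U X s * U X t = U X (s + t) := by
  let _ : NormedAlgebra ℚ (H →L[ℂ] H) := NormedAlgebra.restrictScalars ℚ ℂ (H →L[ℂ] H)
  unfold U
  rw [add_smul, NormedSpace.exp_add_of_commute]
  exact ((Commute.refl _).smul_left _).smul_right _

lemma fc_id {X : H →L[ℂ] H} (hX : IsSelfAdjoint X) : cfc (fun z : ℂ => (z.re : ℂ)) X = X := by
  have := hX.isStarNormal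
  conv_rhs => rw [← cfc_id' ℂ X]
  exact cfc_congr fun z hz => (hX.mem_spectrum_eq_re hz).symm

lemma U_eq {X : H →L[ℂ] H} (hX : IsSelfAdjoint X) (α : ℝ) :
    U X α = cfc (fun z : ℂ => Complex.exp (Complex.I * α * (z.re : ℂ))) X := by
  have := hX.isStarNormal
  have h1 : α • (Complex.I • X) = cfc (fun z : ℂ => Complex.I * α * (z.re : ℂ)) X := by
    rw [cfc_const_mul _ _ X (by fun_prop), fc_id hX, mul_comm, mul_smul]
    rfl
  have h2 : IsStarNormal (α • (Complex.I • X)) := by rw [h1]; exact cfc_predicate _ _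
  rw [U, ← CFC.complex_exp_eq_normedSpace_exp, h1, ← cfc_comp' _ _ X (by fun_prop) (by fun_prop)]

lemma norm_exp_aux (α t : ℝ) : ‖Complex.exp (Complex.I * α * (t : ℂ))‖ = 1 := by
  rw [Complex.norm_exp]; simp

lemma U_norm {X : H →L[ℂ] H} (hX : IsSelfAdjoint X) (α : ℝ) : ‖U X α‖ ≤ 1 := by
  rw [U_eq hX]
  exact norm_cfc_le zero_le_one fun z _ => (norm_exp_aux _ _).le

lemma duhamel (X Y : H →L[ℂ] H) (α : ℝ) :
    Y * U X α - U X α * Y = ∫ s in Set.Ioc (0 : ℝ) 1,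
      U X ((1 - s) * α) * ((α * Complex.I) • (Y * X - X * Y)) * U X (s * α) := by
  have hU := U_cont X
  set Z : H →L[ℂ] H := α • (Complex.I • X) with hZ
  have hUZ : ∀ s : ℝ, U X (s * α) = NormedSpace.exp (s • Z) := by
    intro s; rw [U, hZ, smul_smul s]
  have hder : ∀ s : ℝ, HasDerivAt
      (fun s => NormedSpace.exp ((1 - s) • Z) * Y * NormedSpace.exp (s • Z))
      (U X ((1 - s) * α) * ((α * Complex.I) • (Y * X - X * Y)) * U X (s * α)) s := by
    intro s
    have h1 : HasDerivAt (fun s : ℝ => NormedSpace.exp (s • Z)) (Z * NormedSpace.exp (s • Z)) s :=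
      hasDerivAt_exp_smul_const' Z s
    have h2 : HasDerivAt (fun s : ℝ => NormedSpace.exp ((1 - s) • Z))
        ((-1 : ℝ) • (NormedSpace.exp ((1 - s) • Z) * Z)) s :=
      (hasDerivAt_exp_smul_const Z (1 - s)).scomp s ((hasDerivAt_id s).const_sub 1)
    have h3 := (h2.mul_const Y).mul h1
    refine h3.congr_deriv ?_
    rw [hUZ, hUZ]
    have h4 : (α * Complex.I) • (Y * X - X * Y) = Y * Z - Z * Y := by
      have : Z = (α * Complex.I) • X := by rw [hZ, mul_smul]; rfl
      rw [this, mul_smul_comm, smul_mul_assoc, smul_sub]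
    rw [h4]
    simp only [neg_smul, one_smul]
    noncomm_ring
  have h := intervalIntegral.integral_eq_sub_of_hasDerivAt (a := 0) (b := 1)
    (fun s _ => hder s) (Continuous.intervalIntegrable (by fun_prop) _ _)
  rw [intervalIntegral.integral_of_le zero_le_one] at h
  rw [h]
  have h1 := hUZ 1
  rw [one_mul] at h1
  simp [h1, NormedSpace.exp_zero]

section Main
variable {ι : Type*} (e : HilbertBasis ι ℂ H)

lemma tc_U {X D : H →L[ℂ] H} (hX : IsSelfAdjoint X) (hD : IsSelfAdjoint D)
    (hS : Summable fun j => ‖D (e j)‖ ^ 2) (s t : ℝ) :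
    TC e (∑' j, ‖D (e j)‖ ^ 2) (U X s * (D * D) * U X t) := by
  refine (tc_mul e hD hS (U X s) (U X t)).mono e ?_
  have hM : 0 ≤ ∑' j, ‖D (e j)‖ ^ 2 := tsum_nonneg fun _ => by positivity
  refine mul_le_of_le_one_left hM ?_
  have h1 : ‖U X s‖ ^ 2 ≤ 1 := pow_le_one₀ (norm_nonneg _) (U_norm hX s)
  have h2 : ‖U X t‖ ^ 2 ≤ 1 := pow_le_one₀ (norm_nonneg _) (U_norm hX t)
  linarith

lemma U_zero (X : H →L[ℂ] H) : U X 0 = 1 := by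
  simp [U, NormedSpace.exp_zero]

lemma tc_U' {X D : H →L[ℂ] H} (hX : IsSelfAdjoint X) (hD : IsSelfAdjoint D)
    (hS : Summable fun j => ‖D (e j)‖ ^ 2) (s : ℝ) :
    TC e (∑' j, ‖D (e j)‖ ^ 2) (U X s * (D * D)) := by
  have h := tc_U e hX hD hS s 0
  rwa [U_zero, mul_one] at h

lemma comm_U {X Y D : H →L[ℂ] H} (hX : IsSelfAdjoint X) (hD : IsSelfAdjoint D)
    (hS : Summable fun j => ‖D (e j)‖ ^ 2)
    (hc : Y * X - X * Y = Complex.I • (D * D)) (α : ℝ) :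
    TC e (|α| * ∑' j, ‖D (e j)‖ ^ 2) (Y * U X α - U X α * Y) ∧
    trace e (Y * U X α - U X α * Y) = -α * trace e (U X α * (D * D)) := by
  have := countable_index e
  have hU := U_cont X
  have h1 : ∀ s : ℝ, U X ((1 - s) * α) * ((α * Complex.I) • (Y * X - X * Y)) * U X (s * α) =
      (-α : ℂ) • (U X ((1 - s) * α) * (D * D) * U X (s * α)) := by
    intro s
    rw [hc, smul_smul, mul_smul_comm, smul_mul_assoc]
    congr 1
    rw [mul_assoc, Complex.I_mul_I]; ring
  have h2 : ∀ s : ℝ, TC e (|α| * ∑' j, ‖D (e j)‖ ^ 2)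
      ((-α : ℂ) • (U X ((1 - s) * α) * (D * D) * U X (s * α))) := by
    intro s
    have := (tc_U e hX hD hS ((1 - s) * α) (s * α)).smul e (-α : ℂ)
    rwa [norm_neg, Complex.norm_real, Real.norm_eq_abs] at this
  have h3 : Integrable (fun s : ℝ => (-α : ℂ) • (U X ((1 - s) * α) * (D * D) * U X (s * α)))
      (volume.restrict (Set.Ioc (0 : ℝ) 1)) := by
    have : Continuous
      (fun s : ℝ => (-α : ℂ) • (U X ((1 - s) * α) * (D * D) * U X (s * α))) := by fun_prop
    exact (this.integrableOn_Icc (a := 0) (b := 1)).mono_set Set.Ioc_subset_Icc_self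
  have h4 : Integrable (fun _ : ℝ => |α| * ∑' j, ‖D (e j)‖ ^ 2)
      (volume.restrict (Set.Ioc (0 : ℝ) 1)) := integrable_const _
  rw [duhamel]
  simp_rw [h1]
  constructor
  · have := TC.integral e h3 h4 h2
    simpa using this
  · rw [trace_integral e h3 h4 h2]
    have h5 : ∀ s : ℝ, trace e ((-α : ℂ) • (U X ((1 - s) * α) * (D * D) * U X (s * α))) =
        -α * trace e (U X α * (D * D)) := by
      intro s
      rw [trace_smul, trace_cyc e hD hS, U_add]
      congr 5; ring
    simp_rw [h5]
    simp

lemma fc_integral {X : H →L[ℂ] H} (hX : IsSelfAdjoint X) {g : ℝ → ℂ} (hg : Integrable g) :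
    fc (fun β => ∫ α : ℝ, Complex.exp (Complex.I * (α : ℂ) * (β : ℂ)) * g α) X =
      ∫ α : ℝ, g α • U X α := by
  have hn := hX.isStarNormal
  have hcont : ∀ α : ℝ, ContinuousOn
      (fun z : ℂ => Complex.exp (Complex.I * (α : ℂ) * (z.re : ℂ)) * g α) (spectrum ℂ X) := by
    intro α; fun_prop
  let E : C(ℝ × spectrum ℂ X, ℂ) :=
    ⟨fun q => Complex.exp (Complex.I * (q.1 : ℂ) * ((q.2 : ℂ).re : ℂ)), by fun_prop⟩
  have hmk : ∀ α : ℝ, ContinuousMap.mkD ((spectrum ℂ X).domRestrict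
      (fun z : ℂ => Complex.exp (Complex.I * (α : ℂ) * (z.re : ℂ)) * g α)) 0 =
      g α • E.curry α := by
    intro α
    rw [ContinuousMap.mkD_of_continuousOn (hcont α)]
    ext z
    simp [E, mul_comm]
  unfold fc
  rw [cfc_integral' _ X (Filter.Eventually.of_forall hcont)]
  · refine integral_congr_ae (Filter.Eventually.of_forall fun α => ?_)
    simp only
    rw [U_eq hX, ← cfc_const_mul _ _ X (by fun_prop)]
    simp_rw [mul_comm]
  · simp_rw [hmk]
    refine Integrable.mono' hg.norm
      (hg.aestronglyMeasurable.smul E.curry.continuous.aestronglyMeasurable) ?_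
    refine Filter.Eventually.of_forall fun α => ?_
    rw [norm_smul]
    refine mul_le_of_le_one_right (norm_nonneg _) ?_
    rw [ContinuousMap.norm_le _ zero_le_one]
    intro z
    exact (norm_exp_aux _ _).le

lemma integrable_U {X : H →L[ℂ] H} (hX : IsSelfAdjoint X) {g : ℝ → ℂ} (hg : Integrable g) :
    Integrable fun α => g α • U X α := by
  refine Integrable.mono' hg.norm
      (hg.aestronglyMeasurable.smul (U_cont X).aestronglyMeasurable) ?_
  refine Filter.Eventually.of_forall fun α => ?_
  rw [norm_smul]
  exact mul_le_of_le_one_right (norm_nonneg _) (U_norm hX α)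

lemma deriv_fourier {g : ℝ → ℂ} (hg : Integrable g) (hg' : Integrable fun α : ℝ => α • g α) :
    deriv (fun β : ℝ => ∫ α : ℝ, Complex.exp (Complex.I * (α : ℂ) * (β : ℂ)) * g α) =
    fun β : ℝ => ∫ α : ℝ, Complex.exp (Complex.I * (α : ℂ) * (β : ℂ)) *
      (Complex.I * (α * g α)) := by
  funext β
  have hm : ∀ β : ℝ, AEStronglyMeasurable
      (fun α : ℝ => Complex.exp (Complex.I * (α : ℂ) * (β : ℂ))) volume := fun β =>
    Continuous.aestronglyMeasurable (by fun_prop)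
  have hg2 : Integrable fun α : ℝ => Complex.I * (α * g α) := hg'.const_mul Complex.I
  refine (hasDerivAt_integral_of_dominated_loc_of_deriv_le (𝕜 := ℝ) (μ := volume) (s := Set.univ)
    (F := fun (b : ℝ) (α : ℝ) => Complex.exp (Complex.I * (α : ℂ) * (b : ℂ)) * g α)
    (F' := fun (b : ℝ) (α : ℝ) => Complex.exp (Complex.I * (α : ℂ) * (b : ℂ)) *
      (Complex.I * (α * g α)))
    (bound := fun α => ‖Complex.I * (α * g α)‖) Filter.univ_mem ?_ ?_ ?_ ?_ hg2.norm ?_).2.deriv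
  · exact Filter.Eventually.of_forall fun β => (hm β).mul hg.aestronglyMeasurable
  · refine Integrable.mono' hg.norm ((hm β).mul hg.aestronglyMeasurable) ?_
    refine Filter.Eventually.of_forall fun α => ?_
    rw [norm_mul, norm_exp_aux, one_mul]
  · exact (hm β).mul hg2.aestronglyMeasurable
  · refine Filter.Eventually.of_forall fun α β _ => ?_
    rw [norm_mul, norm_exp_aux, one_mul]
  · refine Filter.Eventually.of_forall fun α β _ => ?_
    have h1 : HasDerivAt (fun b : ℝ => Complex.I * (α : ℂ) * (b : ℂ)) (Complex.I * (α : ℂ)) β := by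
      simpa using (Complex.ofRealCLM.hasDerivAt (x := β)).const_mul (Complex.I * (α : ℂ))
    refine (h1.cexp.mul_const (g α)).congr_deriv ?_
    ring

lemma main_fourier {X Y D : H →L[ℂ] H} (hX : IsSelfAdjoint X) (hD : IsSelfAdjoint D)
    (hS : Summable fun j => ‖D (e j)‖ ^ 2)
    (hc : Y * X - X * Y = Complex.I • (D * D)) {g : ℝ → ℂ} (hg : Integrable g)
    (hg' : Integrable fun α : ℝ => α • g α) (ψ : ℝ → ℂ)
    (hψ : ψ = fun β : ℝ => ∫ α : ℝ, Complex.exp (Complex.I * (α : ℂ) * (β : ℂ)) * g α) :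
    IsTraceClass e (Y * fc ψ X - fc ψ X * Y) ∧
    (-Complex.I) * trace e (Y * fc ψ X - fc ψ X * Y) =
      trace e (fc (deriv ψ) X * (D * D)) := by
  have := countable_index e
  set M := ∑' j, ‖D (e j)‖ ^ 2
  have hg2 : Integrable fun α : ℝ => Complex.I * (α * g α) := hg'.const_mul Complex.I
  have hiU := integrable_U hX hg
  have hK : Integrable fun α : ℝ => ‖g α‖ * (|α| * M) := by
    refine (hg'.norm.mul_const M).congr (Filter.Eventually.of_forall fun α => ?_)
    simp only [norm_smul, Real.norm_eq_abs]; ring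
  have h1 : Y * fc ψ X - fc ψ X * Y = ∫ α, g α • (Y * U X α - U X α * Y) := by
    rw [hψ, fc_integral hX hg, ← integral_const_mul_of_integrable hiU,
      ← integral_mul_const_of_integrable hiU, ← integral_sub (hiU.const_mul Y) (hiU.mul_const Y)]
    simp_rw [mul_smul_comm, smul_mul_assoc, smul_sub]
  have hF : Integrable fun α => g α • (Y * U X α - U X α * Y) := by
    refine ((hiU.const_mul Y).sub (hiU.mul_const Y)).congr (Filter.Eventually.of_forall fun α => ?_)
    simp [smul_sub]
  have hT : ∀ α, TC e (‖g α‖ * (|α| * M)) (g α • (Y * U X α - U X α * Y)) := fun α =>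
    (comm_U e hX hD hS hc α).1.smul e (g α)
  have h2 : fc (deriv ψ) X * (D * D) = ∫ α : ℝ, (Complex.I * (α * g α)) • (U X α * (D * D)) := by
    have hi := integrable_U hX hg2
    rw [hψ, deriv_fourier hg hg', fc_integral hX hg2, ← integral_mul_const_of_integrable hi]
    simp_rw [smul_mul_assoc]
  have hF2 : Integrable fun α : ℝ => (Complex.I * (α * g α)) • (U X α * (D * D)) := by
    refine ((integrable_U hX hg2).mul_const (D * D)).congr (Filter.Eventually.of_forall fun α => ?_)
    simp
  have hT2 : ∀ α : ℝ, TC e (‖Complex.I * (α * g α)‖ * M)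
      ((Complex.I * (α * g α)) • (U X α * (D * D))) := fun α =>
    (tc_U' e hX hD hS α).smul e _
  rw [h1, h2]
  refine ⟨(TC.integral e hF hK hT).isTraceClass e, ?_⟩
  rw [trace_integral e hF hK hT, trace_integral e hF2 (hg2.norm.mul_const M) hT2,
    ← integral_const_mul]
  refine integral_congr_ae (Filter.Eventually.of_forall fun α => ?_)
  simp only [trace_smul, (comm_U e hX hD hS hc α).2]
  ring

lemma main_pow {X Y D : H →L[ℂ] H} (hD : IsSelfAdjoint D)
    (hS : Summable fun j => ‖D (e j)‖ ^ 2)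
    (hc : Y * X - X * Y = Complex.I • (D * D)) (n : ℕ) : ∀ m : ℕ,
    (∃ K, TC e K ((Y * X ^ n - X ^ n * Y) * X ^ m)) ∧
    trace e ((Y * X ^ n - X ^ n * Y) * X ^ m) =
      Complex.I * n * trace e (X ^ (n - 1 + m) * (D * D)) := by
  induction n with
  | zero =>
    intro m
    simp only [pow_zero, mul_one, one_mul, sub_self, zero_mul]
    exact ⟨⟨0, fun W _ F => by simp⟩, by simp [trace]⟩
  | succ n ih =>
    intro m
    obtain ⟨⟨K, hK⟩, ht⟩ := ih (m + 1)
    have h1 : (Y * X ^ (n + 1) - X ^ (n + 1) * Y) * X ^ m =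
        (Y * X ^ n - X ^ n * Y) * X ^ (m + 1) + Complex.I • (X ^ n * (D * D) * X ^ m) := by
      rw [← smul_mul_assoc, ← mul_smul_comm, ← hc, pow_succ, pow_succ']
      noncomm_ring
    have h2 := (tc_mul e hD hS (X ^ n) (X ^ m)).smul e Complex.I
    rw [h1]
    refine ⟨⟨_, hK.add e h2⟩, ?_⟩
    rw [trace_add e hK h2, trace_smul, trace_cyc e hD hS, ht, ← pow_add]
    rcases n with _ | n
    · simp
    · have e1 : n + 1 - 1 + (m + 1) = m + (n + 1) := by omega
      have e2 : n + 1 + 1 - 1 + m = m + (n + 1) := by omega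
      rw [e1, e2]; push_cast; ring

lemma main_poly {X Y D : H →L[ℂ] H} (hD : IsSelfAdjoint D)
    (hS : Summable fun j => ‖D (e j)‖ ^ 2)
    (hc : Y * X - X * Y = Complex.I • (D * D)) (p : Polynomial ℂ) :
    (∃ K, TC e K (Y * aeval X p - aeval X p * Y)) ∧
    (-Complex.I) * trace e (Y * aeval X p - aeval X p * Y) =
      trace e (aeval X (derivative p) * (D * D)) := by
  have hB : ∀ B : H →L[ℂ] H, ∃ K, TC e K (B * (D * D)) := fun B =>
    ⟨_, by have := tc_mul e hD hS B 1; rwa [mul_one] at this⟩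
  induction p using Polynomial.induction_on' with
  | add p q hp hq =>
    obtain ⟨⟨K, hK⟩, h1⟩ := hp
    obtain ⟨⟨L, hL⟩, h2⟩ := hq
    obtain ⟨K', hK'⟩ := hB (aeval X (derivative p))
    obtain ⟨L', hL'⟩ := hB (aeval X (derivative q))
    have h3 : Y * aeval X (p + q) - aeval X (p + q) * Y =
        (Y * aeval X p - aeval X p * Y) + (Y * aeval X q - aeval X q * Y) := by
      rw [map_add]; noncomm_ring
    rw [h3]
    refine ⟨⟨_, hK.add e hL⟩, ?_⟩
    rw [trace_add e hK hL, derivative_add, map_add, add_mul, trace_add e hK' hL', mul_add, h1, h2]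
  | monomial n c =>
    obtain ⟨⟨K, hK⟩, h1⟩ := main_pow e hD hS hc n 0
    rw [pow_zero, mul_one] at hK h1
    have h3 : Y * aeval X (monomial n c) - aeval X (monomial n c) * Y =
        c • (Y * X ^ n - X ^ n * Y) := by
      rw [aeval_monomial, ← Algebra.smul_def, mul_smul_comm, smul_mul_assoc, smul_sub]
    rw [h3]
    refine ⟨⟨_, hK.smul e c⟩, ?_⟩
    rw [trace_smul, h1, derivative_monomial, aeval_monomial, ← Algebra.smul_def, smul_mul_assoc,
      trace_smul, add_zero]
    linear_combination (-c * n * trace e (X ^ (n - 1) * (D * D))) * Complex.I_mul_I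

lemma fc_poly {X : H →L[ℂ] H} (hX : IsSelfAdjoint X) (p : Polynomial ℂ) :
    fc (fun t => p.eval (t : ℂ)) X = aeval X p := by
  have := hX.isStarNormal
  rw [← cfc_polynomial p X, fc]
  refine cfc_congr fun z hz => ?_
  rw [← hX.mem_spectrum_eq_re hz]

lemma deriv_poly (p : Polynomial ℂ) :
    deriv (fun t : ℝ => p.eval (t : ℂ)) = fun t : ℝ => (derivative p).eval (t : ℂ) := by
  funext t
  exact (p.hasDerivAt (t : ℂ)).comp_ofReal.deriv

end Main

theorem statement2 {ι : Type*} (e : HilbertBasis ι ℂ H) (X Y D2 : H →L[ℂ] H)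
    (a b : ℝ) (hA : AssumptionA e X Y D2 a b)
    (ψ : ℝ → ℂ) (hψ : GoodFun ψ) :
    IsTraceClass e (Y * fc ψ X - fc ψ X * Y) ∧
    (-Complex.I) * trace e (Y * fc ψ X - fc ψ X * Y) = trace e (fc (deriv ψ) X * D2) := by

  obtain ⟨D, hD, hDD, hS⟩ := exists_sqrt e hA.hpos hA.htc
  have hc : Y * X - X * Y = Complex.I • (D * D) := by
    have h := congrArg (fun A => (Complex.I / 2) • A) hA.hD2
    simp only [smul_smul] at h
    have h1 : Complex.I / 2 * 2 = Complex.I := by ring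
    have h2 : Complex.I / 2 * (-(2 : ℂ) * Complex.I) = 1 := by
      linear_combination -Complex.I_mul_I
    rw [h1, h2, one_smul] at h
    rw [hDD, h]
  rw [← hDD]
  rcases hψ with ⟨g, hg, hg', hψ⟩ | ⟨p, hp⟩
  · refine main_fourier e hA.hX hD hS hc (g := fun α => (Real.sqrt (2 * Real.pi))⁻¹ • g α)
      (hg.smul (Real.sqrt (2 * Real.pi))⁻¹) ?_ ψ ?_
    · refine (hg'.smul (Real.sqrt (2 * Real.pi))⁻¹).congr
        (Filter.Eventually.of_forall fun α => ?_)
      exact smul_comm (Real.sqrt (2 * Real.pi))⁻¹ α (g α)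
    · funext β
      rw [hψ, ← integral_smul]
      refine integral_congr_ae (Filter.Eventually.of_forall fun α => ?_)
      simp only [smul_eq_mul]
      exact (mul_smul_comm _ _ _).symm
  · obtain rfl : ψ = fun t : ℝ => p.eval (t : ℂ) := funext hp
    rw [deriv_poly, fc_poly hA.hX, fc_poly hA.hX]
    obtain ⟨⟨K, hK⟩, h⟩ := main_poly e hD hS hc p
    exact ⟨hK.isTraceClass e, h⟩

end HHCP
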